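/- arXiv:1708.00582 — 3 statements merged into one kernel-verified Lean document; each statement's English description precedes it below -/
import Mathlib

section
/- Let D=(V,A) be a finite digraph. Define the bipartite graph Ĝ=(V̂,Ê) with color classes V̂⁺ = {u⁺ : u ∈ V} and V̂⁻ = {u⁻ : u ∈ V} and edge set Ê = {{u⁺,v⁻} : (u,v) ∈ A}, and define Û = { Û : U ⊆ V, |U| odd }, where Û = ∪_{u∈U} {u⁺, u⁻}. For F ⊆ A let F̂ = {{u⁺,v⁻} : (u,v) ∈ F}. Then F is an even factor of D if and only if F̂ is a Û-feasible 1-matching of Ĝ. -/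
open scoped Classical

noncomputable section

section Undirected

variable {W : Type*} [Fintype W] [DecidableEq W]

/-- `deg_F(v)`: the number of edges of `F` incident to the vertex `v`. -/
def degF (F : Finset (Sym2 W)) (v : W) : ℕ := (F.filter (fun e => v ∈ e)).card

/-- `F[X]`: the set of edges of `F` with both endpoints in `X`. -/
def inducedEdges (F : Finset (Sym2 W)) (X : Finset W) : Finset (Sym2 W) :=
  F.filter (fun e => ∀ v ∈ e, v ∈ X)

/-- `F` is a `t`-matching: every vertex is incident to at most `t` edges of `F`. -/
def IsTMatching (F : Finset (Sym2 W)) (t : ℕ) : Prop := ∀ v : W, degF F v ≤ t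

/-- `⌊(t·|U| - 1)/2⌋` as an integer. -/
def ufBound (t : ℕ) (U : Finset W) : ℤ := ⌊((t * U.card - 1 : ℚ) / 2)⌋

/-- A `t`-matching `F` is `𝒰`-feasible if `|F[U]| ≤ ⌊(t·|U| - 1)/2⌋` for every `U ∈ 𝒰`. -/
def IsUFeasible (F : Finset (Sym2 W)) (𝒰 : Finset (Finset W)) (t : ℕ) : Prop :=
  ∀ U ∈ 𝒰, ((inducedEdges F U).card : ℤ) ≤ ufBound t U

end Undirected

variable {V : Type*} [Fintype V] [DecidableEq V]

/-- The number of arcs of `F` leaving `v`. -/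
def outDeg (F : Finset (V × V)) (v : V) : ℕ := (F.filter (fun a => a.1 = v)).card

/-- The number of arcs of `F` entering `v`. -/
def inDeg (F : Finset (V × V)) (v : V) : ℕ := (F.filter (fun a => a.2 = v)).card

/-- `F` is a path-cycle factor: every vertex has at most one outgoing and
at most one incoming arc in `F`. -/
def IsPathCycleFactor (F : Finset (V × V)) : Prop :=
  ∀ v : V, outDeg F v ≤ 1 ∧ inDeg F v ≤ 1

/-- `F` contains a directed cycle of odd length. -/
def HasOddDicycle (F : Finset (V × V)) : Prop :=
  ∃ (k : ℕ) (c : ZMod k → V), 0 < k ∧ Odd k ∧ Function.Injective c ∧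
    ∀ i : ZMod k, (c i, c (i + 1)) ∈ F

/-- `F` is an even factor: a path-cycle factor with no odd directed cycle. -/
def IsEvenFactor (F : Finset (V × V)) : Prop :=
  IsPathCycleFactor F ∧ ¬ HasOddDicycle F

/-- `Û = U⁺ ∪ U⁻ ⊆ V̂ = V ⊕ V` for `U ⊆ V`. -/
def hatVertexSet (U : Finset V) : Finset (V ⊕ V) :=
  U.image Sum.inl ∪ U.image Sum.inr

/-- The edge set `{ {u⁺, v⁻} : (u,v) ∈ F }` of the bipartite graph `Ĝ`,
for an arc set `F ⊆ A`. -/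
def hatArcs (F : Finset (V × V)) : Finset (Sym2 (V ⊕ V)) :=
  F.image (fun a => s(Sum.inl a.1, Sum.inr a.2))

/-- `Û = { Û : U ⊆ V, |U| odd }`. -/
def oddFamily (V : Type*) [Fintype V] [DecidableEq V] : Finset (Finset (V ⊕ V)) :=
  ((Finset.univ : Finset (Finset V)).filter (fun U => Odd U.card)).image hatVertexSet

set_option linter.unusedSectionVars false

/-- The map sending an arc `(u, v)` to the edge `{u⁺, v⁻}` is injective. -/
lemma hatEdge_injective :
    Function.Injective (fun a : V × V => (s(Sum.inl a.1, Sum.inr a.2) : Sym2 (V ⊕ V))) := by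
  rintro ⟨a, b⟩ ⟨c, d⟩ h
  simpa using h

lemma degF_hatArcs_inl (F : Finset (V × V)) (u : V) :
    degF (hatArcs F) (Sum.inl u) = outDeg F u := by
  unfold degF hatArcs outDeg
  rw [Finset.filter_image, Finset.card_image_of_injective _ hatEdge_injective]
  congr 1
  ext a
  simp [eq_comm]

lemma degF_hatArcs_inr (F : Finset (V × V)) (u : V) :
    degF (hatArcs F) (Sum.inr u) = inDeg F u := by
  unfold degF hatArcs inDeg
  rw [Finset.filter_image, Finset.card_image_of_injective _ hatEdge_injective]
  congr 1
  ext a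
  simp [eq_comm]

lemma isTMatching_hatArcs_iff (F : Finset (V × V)) :
    IsTMatching (hatArcs F) 1 ↔ IsPathCycleFactor F := by
  simp only [IsTMatching, IsPathCycleFactor, Sum.forall, degF_hatArcs_inl, degF_hatArcs_inr,
    forall_and]

lemma card_inducedEdges_hatArcs (F : Finset (V × V)) (U : Finset V) :
    (inducedEdges (hatArcs F) (hatVertexSet U)).card
      = (F.filter (fun a => a.1 ∈ U ∧ a.2 ∈ U)).card := by
  unfold inducedEdges hatArcs
  rw [Finset.filter_image, Finset.card_image_of_injective _ hatEdge_injective]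
  congr 1
  ext a
  simp [hatVertexSet]

lemma ufBound_hatVertexSet (U : Finset V) : ufBound 1 (hatVertexSet U) = (U.card : ℤ) - 1 := by
  have hcard : (hatVertexSet U).card = 2 * U.card := by
    unfold hatVertexSet
    rw [Finset.card_union_of_disjoint, Finset.card_image_of_injective _ Sum.inl_injective,
      Finset.card_image_of_injective _ Sum.inr_injective, two_mul]
    simp [Finset.disjoint_left]
  unfold ufBound
  rw [hcard, Int.floor_eq_iff]
  push_cast
  constructor <;> linarith

lemma isUFeasible_hatArcs_iff (F : Finset (V × V)) :
    IsUFeasible (hatArcs F) (oddFamily V) 1 ↔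
      ∀ U : Finset V, Odd U.card → (F.filter (fun a => a.1 ∈ U ∧ a.2 ∈ U)).card < U.card := by
  simp only [IsUFeasible, oddFamily, Finset.forall_mem_image, Finset.mem_filter,
    Finset.mem_univ, true_and, ufBound_hatVertexSet, card_inducedEdges_hatArcs]
  refine forall₂_congr fun U _ => ?_
  omega

lemma IsPathCycleFactor.injOn_fst {F : Finset (V × V)} (h : IsPathCycleFactor F) :
    Set.InjOn Prod.fst (F : Set (V × V)) := fun a ha b hb hab =>
  Finset.card_le_one.1 (h b.1).1 a (Finset.mem_filter.2 ⟨ha, hab⟩) b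
    (Finset.mem_filter.2 ⟨hb, rfl⟩)

lemma IsPathCycleFactor.injOn_snd {F : Finset (V × V)} (h : IsPathCycleFactor F) :
    Set.InjOn Prod.snd (F : Set (V × V)) := fun a ha b hb hab =>
  Finset.card_le_one.1 (h b.2).2 a (Finset.mem_filter.2 ⟨ha, hab⟩) b
    (Finset.mem_filter.2 ⟨hb, rfl⟩)

/-- A permutation of a type of odd cardinality has a point of odd minimal period. -/
lemma exists_odd_minimalPeriod {α : Type*} [Fintype α] (h : Odd (Fintype.card α))
    (σ : Equiv.Perm α) : ∃ x, Odd (Function.minimalPeriod σ x) := by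
  obtain ⟨n, m, hm, hn⟩ := Nat.exists_eq_two_pow_mul_odd (orderOf_pos σ).ne'
  have hσ : (σ ^ m) ^ 2 ^ n = 1 := by
    rw [← pow_mul, mul_comm, ← hn, pow_orderOf_eq_one]
  obtain ⟨x, hx⟩ := Equiv.Perm.exists_fixed_point_of_prime h.not_two_dvd_nat hσ
  refine ⟨x, hm.of_dvd_nat (Function.IsPeriodicPt.minimalPeriod_dvd ?_)⟩
  rwa [Function.IsPeriodicPt, Function.IsFixedPt, Equiv.Perm.iterate_eq_pow]

/-- A self-map whose graph maps into `F` and which has a point of odd minimal period gives an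
odd directed cycle in `F`. -/
lemma HasOddDicycle.of_odd_minimalPeriod {α : Type*} {F : Finset (V × V)} {f : α → α}
    {g : α → V} (hg : Function.Injective g) (hF : ∀ x, (g x, g (f x)) ∈ F) {x : α}
    (hx : Odd (Function.minimalPeriod f x)) : HasOddDicycle F := by
  have : NeZero (Function.minimalPeriod f x) := ⟨hx.pos.ne'⟩
  refine ⟨Function.minimalPeriod f x, fun i => g (f^[i.val] x), hx.pos, hx, ?_, fun i => ?_⟩
  · intro i j hij
    exact ZMod.val_injective _ (Function.iterate_injOn_Iio_minimalPeriod
      (ZMod.val_lt i) (ZMod.val_lt j) (hg hij))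
  · have hstep : f^[(i + 1).val] x = f (f^[i.val] x) := by
      rw [ZMod.val_add, ZMod.val_one_eq_one_mod, Nat.add_mod_mod,
        Function.iterate_mod_minimalPeriod_eq, Function.iterate_succ_apply']
    simpa only [hstep] using hF (f^[i.val] x)

lemma IsPathCycleFactor.hasOddDicycle_of_card_le {F : Finset (V × V)} (h : IsPathCycleFactor F)
    {U : Finset V} (hU : Odd U.card)
    (hcard : U.card ≤ (F.filter (fun a => a.1 ∈ U ∧ a.2 ∈ U)).card) : HasOddDicycle F := by
  set S := F.filter (fun a => a.1 ∈ U ∧ a.2 ∈ U) with hS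
  have himage : S.image Prod.fst = U := by
    refine Finset.eq_of_subset_of_card_le ?_ ?_
    · intro u hu
      obtain ⟨a, ha, rfl⟩ := Finset.mem_image.1 hu
      exact (Finset.mem_filter.1 ha).2.1
    · rwa [Finset.card_image_of_injOn (h.injOn_fst.mono (Finset.coe_subset.2 (Finset.filter_subset _ _)))]
  have hout : ∀ u : U, ∃ v : U, ((u : V), (v : V)) ∈ F := by
    rintro ⟨u, hu⟩
    rw [← himage] at hu
    obtain ⟨a, ha, rfl⟩ := Finset.mem_image.1 hu
    obtain ⟨haF, -, ha2⟩ := Finset.mem_filter.1 ha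
    exact ⟨⟨a.2, ha2⟩, haF⟩
  choose f hf using hout
  have hinj : Function.Injective f := fun u v huv =>
    Subtype.ext (congrArg Prod.fst (h.injOn_snd (hf u) (hf v) (congrArg Subtype.val huv)))
  obtain ⟨x, hx⟩ := exists_odd_minimalPeriod (by simpa using hU)
    (Equiv.ofBijective f (Finite.injective_iff_bijective.1 hinj))
  exact HasOddDicycle.of_odd_minimalPeriod Subtype.val_injective hf hx

lemma HasOddDicycle.exists_odd_card_le {F : Finset (V × V)} (h : HasOddDicycle F) :
    ∃ U : Finset V, Odd U.card ∧ U.card ≤ (F.filter (fun a => a.1 ∈ U ∧ a.2 ∈ U)).card := by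
  obtain ⟨k, c, hk, hodd, hc, hF⟩ := h
  have : NeZero k := ⟨hk.ne'⟩
  have hcard : (Finset.univ.image c).card = k := by
    rw [Finset.card_image_of_injective _ hc, Finset.card_univ, ZMod.card]
  refine ⟨Finset.univ.image c, by rwa [hcard], ?_⟩
  rw [Finset.card_image_of_injective _ hc]
  refine Finset.card_le_card_of_injOn (fun i => (c i, c (i + 1))) ?_ ?_
  · intro i _
    simp [hF]
  · intro i _ j _ hij
    exact hc (congrArg Prod.fst hij)

/-- `F ⊆ A` is an even factor of the digraph `D = (V,A)` if and only if
`F̂ = {{u⁺,v⁻} : (u,v) ∈ F}` is a `Û`-feasible `1`-matching of the bipartite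
graph `Ĝ = (V̂, Ê)`, where `Ê = {{u⁺,v⁻} : (u,v) ∈ A}` and
`Û = { Û : U ⊆ V, |U| odd }`. -/
theorem even_factor_iff_hat_feasible_one_matching
    (A : Finset (V × V)) (F : Finset (V × V)) (hFA : F ⊆ A) :
    IsEvenFactor F ↔
      (hatArcs F ⊆ hatArcs A ∧ IsTMatching (hatArcs F) 1 ∧
        IsUFeasible (hatArcs F) (oddFamily V) 1) := by
  rw [isTMatching_hatArcs_iff, isUFeasible_hatArcs_iff, IsEvenFactor]
  constructor
  · rintro ⟨hpc, hodd⟩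
    refine ⟨Finset.image_subset_image hFA, hpc, fun U hU => ?_⟩
    by_contra! hcard
    exact hodd (hpc.hasOddDicycle_of_card_le hU hcard)
  · rintro ⟨-, hpc, hfeas⟩
    refine ⟨hpc, fun hodd => ?_⟩
    obtain ⟨U, hU, hcard⟩ := hodd.exists_odd_card_le
    exact (hfeas U hU).not_ge hcard
end
end

section
/- Let G=(V,E) be a finite simple undirected graph with edge weights w : E → ℝ₊. Define the bipartite graph Ĝ=(V̂,Ê) with V̂⁺ = {u⁺ : u ∈ V}, V̂⁻ = {u⁻ : u ∈ V}, Ê = ∪_{{u,v}∈E} { {u⁺,v⁻}, {v⁺,u⁻} }, edge weights ŵ({u⁺,v⁻}) = ŵ({v⁺,u⁻}) = w({u,v}), and the family Û = { Û : U ⊆ V, |U| = 3 }, where Û = ∪_{u∈U}{u⁺,u⁻}. Then: (i) for every triangle-free 2-matching x of G there exists a Û-feasible 1-matching F̂ of Ĝ with ŵ(F̂) = Σ_{e∈E} w(e)·x(e), and (ii) for every Û-feasible 1-matching F̂ of Ĝ there exists a triangle-free 2-matching x of G with Σ_{e∈E} w(e)·x(e) = ŵ(F̂). -/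
open scoped Classical

noncomputable section

variable {V : Type*} [Fintype V] [DecidableEq V]

/-- The edge set `Ê = ∪_{{u,v} ∈ E} { {u⁺,v⁻}, {v⁺,u⁻} }` of the bipartite graph `Ĝ`. -/
def hatEdges (G : SimpleGraph V) : Finset (Sym2 (V ⊕ V)) :=
  Finset.univ.filter (fun e => ∃ u v : V, G.Adj u v ∧ e = s(Sum.inl u, Sum.inr v))

/-- Auxiliary function for the weight `ŵ` on the hat graph. -/
def hatwFun (w : Sym2 V → ℝ) : (V ⊕ V) → (V ⊕ V) → ℝ
  | Sum.inl u, Sum.inr v => w s(u, v)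
  | Sum.inr u, Sum.inl v => w s(v, u)
  | Sum.inl _, Sum.inl _ => 0
  | Sum.inr _, Sum.inr _ => 0

/-- The weight `ŵ` on the hat graph: `ŵ({u⁺, v⁻}) = w({u, v})`. -/
def hatw (w : Sym2 V → ℝ) : Sym2 (V ⊕ V) → ℝ :=
  Sym2.lift ⟨hatwFun w, by intro a b; cases a <;> cases b <;> rfl⟩

/-- `Û = { Û : U ⊆ V, |U| = 3 }`. -/
def tripleFamily (V : Type*) [Fintype V] [DecidableEq V] : Finset (Finset (V ⊕ V)) :=
  ((Finset.univ : Finset (Finset V)).filter (fun U => U.card = 3)).image hatVertexSet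

/-- `x` is a `2`-matching of `G`: a vector `x ∈ ℤ₊^E` with `Σ_{e ∈ δ(v)} x e ≤ 2`
for every vertex `v`. -/
def IsTwoMatchingVec (G : SimpleGraph V) (x : Sym2 V → ℕ) : Prop :=
  (∀ e : Sym2 V, x e ≠ 0 → e ∈ G.edgeFinset) ∧
    ∀ v : V, ∑ e ∈ G.edgeFinset.filter (fun e => v ∈ e), x e ≤ 2

/-- The `2`-matching `x` is triangle-free: no triple of edges forming a cycle of
length three each carries value `1`. -/
def IsTriangleFree (G : SimpleGraph V) (x : Sym2 V → ℕ) : Prop :=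
  ¬ ∃ a b c : V, G.Adj a b ∧ G.Adj b c ∧ G.Adj a c ∧
      x s(a, b) = 1 ∧ x s(b, c) = 1 ∧ x s(a, c) = 1

/-- `R` orients every edge of `E` in exactly one direction, and every vertex has at most one
outgoing and at most one incoming arc. -/
structure IsPathOrientation (E : Finset (Sym2 V)) (R : V → V → Prop) : Prop where
  mem_of_rel : ∀ {u v}, R u v → s(u, v) ∈ E
  rel_of_mem : ∀ {u v}, s(u, v) ∈ E → R u v ∨ R v u
  asymm : ∀ {u v}, R u v → ¬ R v u
  out_unique : ∀ {u v v'}, R u v → R u v' → v = v'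
  in_unique : ∀ {u u' v}, R u v → R u' v → u = u'

omit [Fintype V] [DecidableEq V] in
theorem IsPathOrientation.reverse {E : Finset (Sym2 V)} {R : V → V → Prop}
    (h : IsPathOrientation E R) : IsPathOrientation E (fun u v => R v u) where
  mem_of_rel := fun {u v} huv => Sym2.eq_swap (a := u) (b := v) ▸ h.mem_of_rel huv
  rel_of_mem := fun huv => (h.rel_of_mem huv).symm
  asymm := fun huv hvu => h.asymm huv hvu
  out_unique := h.in_unique
  in_unique := h.out_unique

omit [Fintype V] [DecidableEq V] in
/-- If a path orientation has no arc entering `a`, the path starting at `a` can be reversed,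
keeping the arcs at any other vertex `b` without incoming arcs. -/
theorem IsPathOrientation.exists_flip {E : Finset (Sym2 V)} {R : V → V → Prop}
    (h : IsPathOrientation E R) {a b : V} (hab : a ≠ b) (ha : ∀ u, ¬ R u a)
    (hb : ∀ u, ¬ R u b) :
    ∃ R', IsPathOrientation E R' ∧ (∀ u, ¬ R' a u) ∧ ∀ u, ¬ R' u b := by
  have hclosed : ∀ {u v}, R u v → (Relation.ReflTransGen R a u ↔ Relation.ReflTransGen R a v) := by
    intro u v huv
    refine ⟨fun hu => hu.tail huv, fun hv => ?_⟩
    rcases Relation.ReflTransGen.cases_tail hv with rfl | ⟨c, hc, hcv⟩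
    · exact absurd huv (ha u)
    · exact h.in_unique huv hcv ▸ hc
  have hbS : ¬ Relation.ReflTransGen R a b := by
    intro hv
    rcases Relation.ReflTransGen.cases_tail hv with hba | ⟨c, _, hcb⟩
    · exact hab hba.symm
    · exact hb c hcb
  have haS : Relation.ReflTransGen R a a := Relation.ReflTransGen.refl
  generalize Relation.ReflTransGen R a = S at hclosed hbS haS
  refine ⟨fun u v => (S u ∧ R v u) ∨ (¬ S u ∧ R u v), ⟨?_, ?_, ?_, ?_, ?_⟩, ?_, ?_⟩
  · rintro u v (⟨_, hr⟩ | ⟨_, hr⟩)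
    · exact Sym2.eq_swap (a := u) (b := v) ▸ h.mem_of_rel hr
    · exact h.mem_of_rel hr
  · intro u v huv
    rcases h.rel_of_mem huv with hr | hr <;> have := hclosed hr <;> tauto
  · rintro u v (⟨_, hr⟩ | ⟨_, hr⟩) <;> have := hclosed hr <;> have := h.asymm hr <;> tauto
  · rintro u v v' (⟨_, hr⟩ | ⟨_, hr⟩) (⟨_, hr'⟩ | ⟨_, hr'⟩)
    · exact h.in_unique hr hr'
    · contradiction
    · contradiction
    · exact h.out_unique hr hr'
  · rintro u u' v (⟨_, hr⟩ | ⟨_, hr⟩) (⟨_, hr'⟩ | ⟨_, hr'⟩)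
    · exact h.out_unique hr hr'
    · have := hclosed hr; have := hclosed hr'; tauto
    · have := hclosed hr; have := hclosed hr'; tauto
    · exact h.in_unique hr hr'
  · rintro u (⟨_, hr⟩ | ⟨hn, _⟩)
    · exact ha u hr
    · exact hn haS
  · rintro u (⟨_, hr⟩ | ⟨_, hr⟩)
    · exact hbS ((hclosed hr).2 ‹_›)
    · exact hb u hr

omit [Fintype V] in
theorem IsPathOrientation.insert {E : Finset (Sym2 V)} {R : V → V → Prop}
    (h : IsPathOrientation E R) {a b : V} (hab : a ≠ b) (habE : s(a, b) ∉ E)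
    (ha : ∀ u, ¬ R a u) (hb : ∀ u, ¬ R u b) :
    IsPathOrientation (insert s(a, b) E) (fun u v => R u v ∨ (u = a ∧ v = b)) where
  mem_of_rel := by
    rintro u v (hr | ⟨rfl, rfl⟩)
    · exact Finset.mem_insert_of_mem (h.mem_of_rel hr)
    · exact Finset.mem_insert_self _ _
  rel_of_mem := by
    intro u v huv
    rcases Finset.mem_insert.1 huv with he | he
    · rcases Sym2.eq_iff.1 he with ⟨rfl, rfl⟩ | ⟨rfl, rfl⟩ <;> simp
    · rcases h.rel_of_mem he with hr | hr <;> simp [hr]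
  asymm := by
    rintro u v (hr | ⟨rfl, rfl⟩) (hr' | ⟨rfl, h2⟩)
    · exact h.asymm hr hr'
    · exact habE (h2 ▸ Sym2.eq_swap ▸ h.mem_of_rel hr)
    · exact habE (Sym2.eq_swap ▸ h.mem_of_rel hr')
    · exact hab rfl
  out_unique := by
    rintro u v v' (hr | ⟨hu, hv⟩) (hr' | ⟨hu', hv'⟩)
    · exact h.out_unique hr hr'
    · exact absurd (hu' ▸ hr) (ha _)
    · exact absurd (hu ▸ hr') (ha _)
    · exact hv.trans hv'.symm
  in_unique := by
    rintro u u' v (hr | ⟨hu, hv⟩) (hr' | ⟨hu', hv'⟩)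
    · exact h.in_unique hr hr'
    · exact absurd (hv' ▸ hr) (hb _)
    · exact absurd (hv ▸ hr') (hb _)
    · exact hu.trans hu'.symm

/-- At a vertex of degree at most one, a path orientation cannot have both an outgoing and an
incoming arc. -/
theorem IsPathOrientation.not_out_and_in {E : Finset (Sym2 V)} {R : V → V → Prop}
    (h : IsPathOrientation E R) {a : V} (ha : degF E a ≤ 1) :
    (∀ u, ¬ R a u) ∨ ∀ u, ¬ R u a := by
  by_contra! hcon
  obtain ⟨⟨u, hu⟩, v, hv⟩ := hcon
  have he : s(a, u) = s(v, a) := Finset.card_le_one.1 ha _ (by simp [h.mem_of_rel hu]) _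
    (by simp [h.mem_of_rel hv])
  rcases Sym2.eq_iff.1 he with ⟨rfl, rfl⟩ | ⟨_, rfl⟩
  · exact h.asymm hu hu
  · exact h.asymm hu hv

/-- A graph of maximum degree at most two has an orientation with all in- and outdegrees
at most one. -/
theorem exists_isPathOrientation (E : Finset (Sym2 V)) (hdiag : ∀ e ∈ E, ¬ e.IsDiag)
    (hdeg : IsTMatching E 2) : ∃ R, IsPathOrientation E R := by
  induction E using Finset.induction_on with
  | empty => exact ⟨fun _ _ => False, by constructor <;> simp⟩
  | insert e E he ih =>
    have hdeg' : ∀ v, v ∈ e → degF E v ≤ 1 := by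
      intro v hv
      have := hdeg v
      rw [degF, Finset.filter_insert, if_pos hv, Finset.card_insert_of_notMem (by simp [he])] at this
      exact Nat.le_of_succ_le_succ this
    obtain ⟨R, hR⟩ := ih (fun e' he' => hdiag e' (Finset.mem_insert_of_mem he'))
      (fun v => (Finset.card_le_card
        (Finset.filter_subset_filter _ (Finset.subset_insert e E))).trans (hdeg v))
    induction e using Sym2.ind with
    | _ a b =>
    have hab : a ≠ b := by simpa using hdiag _ (Finset.mem_insert_self _ _)
    rcases hR.not_out_and_in (hdeg' a (by simp)) with ha | ha <;>
      rcases hR.not_out_and_in (hdeg' b (by simp)) with hb | hb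
    · obtain ⟨R', hR', ha', hb'⟩ := hR.reverse.exists_flip hab ha hb
      exact ⟨_, hR'.insert hab he ha' hb'⟩
    · exact ⟨_, hR.insert hab he ha hb⟩
    · exact ⟨_, hR.reverse.insert hab he ha hb⟩
    · obtain ⟨R', hR', ha', hb'⟩ := hR.exists_flip hab ha hb
      exact ⟨_, hR'.insert hab he ha' hb'⟩

/-- The edge `{u⁺, v⁻}` of the hat graph attached to the arc `(u, v)`. -/
def hatArc : V × V ↪ Sym2 (V ⊕ V) where
  toFun p := s(Sum.inl p.1, Sum.inr p.2)
  inj' := by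
    rintro ⟨a, b⟩ ⟨c, d⟩ h
    simpa [Sym2.eq_iff] using h

/-- The arcs of `P` with underlying edge `e`. -/
def arcsOver (P : Finset (V × V)) (e : Sym2 V) : Finset (V × V) :=
  P.filter (fun p => s(p.1, p.2) = e)

omit [Fintype V] [DecidableEq V] in
@[simp]
theorem hatArc_apply (p : V × V) : hatArc p = s(Sum.inl p.1, Sum.inr p.2) := rfl

theorem sum_hatw_map_hatArc (G : SimpleGraph V) (w : Sym2 V → ℝ) (P : Finset (V × V))
    (hP : ∀ p ∈ P, G.Adj p.1 p.2) :
    ∑ e ∈ P.map hatArc, hatw w e = ∑ e ∈ G.edgeFinset, w e * ((arcsOver P e).card : ℕ) := by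
  rw [Finset.sum_map, ← Finset.sum_fiberwise_of_maps_to (t := G.edgeFinset)
    (g := fun p : V × V => s(p.1, p.2)) (by simpa using hP)]
  refine Finset.sum_congr rfl fun e _ => ?_
  have : ∀ p ∈ arcsOver P e, hatw w (hatArc p) = w e := by
    intro p hp
    rw [← (Finset.mem_filter.1 hp).2]
    rfl
  rw [mul_comm, ← nsmul_eq_mul]
  exact Finset.sum_eq_card_nsmul this

omit [Fintype V] in
theorem degF_map_hatArc_inl (P : Finset (V × V)) (v : V) :
    degF (P.map hatArc) (Sum.inl v) = (P.filter (fun p => p.1 = v)).card := by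
  rw [degF, Finset.filter_map, Finset.card_map]
  congr 1
  ext p
  simp [eq_comm]

omit [Fintype V] in
theorem degF_map_hatArc_inr (P : Finset (V × V)) (v : V) :
    degF (P.map hatArc) (Sum.inr v) = (P.filter (fun p => p.2 = v)).card := by
  rw [degF, Finset.filter_map, Finset.card_map]
  congr 1
  ext p
  simp [eq_comm]

theorem card_inducedEdges_map_hatArc (P : Finset (V × V)) (U : Finset V) :
    (inducedEdges (P.map hatArc) (hatVertexSet U)).card =
      (P.filter (fun p => p.1 ∈ U ∧ p.2 ∈ U)).card := by
  rw [inducedEdges, Finset.filter_map, Finset.card_map]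
  congr 1
  ext p
  simp [hatVertexSet]

theorem isUFeasible_map_hatArc_iff (P : Finset (V × V)) :
    IsUFeasible (P.map hatArc) (tripleFamily V) 1 ↔
      ∀ U : Finset V, U.card = 3 → (P.filter (fun p => p.1 ∈ U ∧ p.2 ∈ U)).card ≤ 2 := by
  have hbound : ∀ U : Finset V, U.card = 3 → ufBound 1 (hatVertexSet U) = 2 := by
    intro U hU
    have hcard : (hatVertexSet U).card = 6 := by
      rw [hatVertexSet, Finset.card_union_of_disjoint, Finset.card_image_of_injective _
        Sum.inl_injective, Finset.card_image_of_injective _ Sum.inr_injective, hU]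
      simp [Finset.disjoint_left]
    rw [ufBound, hcard, Int.floor_eq_iff]
    norm_num
  simp only [IsUFeasible, tripleFamily, Finset.forall_mem_image, Finset.mem_filter,
    Finset.mem_univ, true_and]
  refine forall₂_congr fun U hU => ?_
  rw [hbound U hU, card_inducedEdges_map_hatArc]
  norm_cast

theorem exists_map_hatArc_eq {G : SimpleGraph V} {F : Finset (Sym2 (V ⊕ V))}
    (hF : F ⊆ hatEdges G) :
    ∃ P : Finset (V × V), (∀ p ∈ P, G.Adj p.1 p.2) ∧ P.map hatArc = F := by
  refine ⟨Finset.univ.filter (fun p => hatArc p ∈ F), ?_, ?_⟩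
  · intro p hp
    obtain ⟨u, v, huv, he⟩ := (Finset.mem_filter.1 (hF (Finset.mem_filter.1 hp).2)).2
    have : p = (u, v) := hatArc.injective he
    simpa [this] using huv
  · ext e
    simp only [Finset.mem_map, Finset.mem_filter, Finset.mem_univ, true_and]
    constructor
    · rintro ⟨p, hp, rfl⟩
      exact hp
    · intro he
      obtain ⟨u, v, _, rfl⟩ := (Finset.mem_filter.1 (hF he)).2
      exact ⟨(u, v), he, rfl⟩

theorem isTwoMatchingVec_card_arcsOver {G : SimpleGraph V} {P : Finset (V × V)}
    (hP : ∀ p ∈ P, G.Adj p.1 p.2) (hM : IsTMatching (P.map hatArc) 1) :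
    IsTwoMatchingVec G (fun e => (arcsOver P e).card) := by
  refine ⟨fun e he => ?_, fun v => ?_⟩
  · obtain ⟨p, hp⟩ := Finset.card_ne_zero.1 he
    obtain ⟨hpP, rfl⟩ := Finset.mem_filter.1 hp
    simpa using hP p hpP
  · have hinl := hM (Sum.inl v)
    have hinr := hM (Sum.inr v)
    rw [degF_map_hatArc_inl] at hinl
    rw [degF_map_hatArc_inr] at hinr
    calc ∑ e ∈ G.edgeFinset.filter (fun e => v ∈ e), (arcsOver P e).card
        = (P.filter (fun p => v ∈ s(p.1, p.2))).card := by
          rw [Finset.card_eq_sum_card_fiberwise (f := fun p : V × V => s(p.1, p.2))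
            (t := G.edgeFinset.filter (fun e => v ∈ e))]
          · refine Finset.sum_congr rfl fun e he => ?_
            rw [arcsOver, Finset.filter_filter]
            congr 1
            refine Finset.filter_congr fun p _ => ?_
            have := (Finset.mem_filter.1 he).2
            constructor
            · rintro rfl
              exact ⟨this, rfl⟩
            · exact fun h => h.2
          · intro p hp
            obtain ⟨hp, hv⟩ := Finset.mem_filter.1 hp
            exact Finset.mem_filter.2 ⟨by simpa using hP p hp, hv⟩
      _ ≤ (P.filter (fun p => p.1 = v) ∪ P.filter (fun p => p.2 = v)).card := by
          refine Finset.card_le_card fun p hp => ?_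
          simp only [Finset.mem_filter, Sym2.mem_iff, Finset.mem_union] at hp ⊢
          obtain ⟨hp, rfl | rfl⟩ := hp <;> simp [hp]
      _ ≤ 1 + 1 := (Finset.card_union_le _ _).trans (add_le_add hinl hinr)

theorem isTriangleFree_card_arcsOver {G : SimpleGraph V} {P : Finset (V × V)}
    (hF : IsUFeasible (P.map hatArc) (tripleFamily V) 1) :
    IsTriangleFree G (fun e => (arcsOver P e).card) := by
  rintro ⟨a, b, c, hab, hbc, hac, h1, h2, h3⟩
  have hU : ({a, b, c} : Finset V).card = 3 :=
    Finset.card_eq_three.2 ⟨a, b, c, hab.ne, hac.ne, hbc.ne, rfl⟩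
  have hle := (isUFeasible_map_hatArc_iff P).1 hF _ hU
  have hsub : ({s(a, b), s(b, c), s(a, c)} : Finset (Sym2 V)) ⊆
      (P.filter (fun p => p.1 ∈ ({a, b, c} : Finset V) ∧ p.2 ∈ ({a, b, c} : Finset V))).image
        (fun p => s(p.1, p.2)) := by
    have key : ∀ u v : V, (arcsOver P s(u, v)).card = 1 → u ∈ ({a, b, c} : Finset V) →
        v ∈ ({a, b, c} : Finset V) → s(u, v) ∈ (P.filter (fun p => p.1 ∈ ({a, b, c} : Finset V) ∧
          p.2 ∈ ({a, b, c} : Finset V))).image (fun p => s(p.1, p.2)) := by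
      intro u v huv hu hv
      obtain ⟨⟨p, q⟩, hpq⟩ := Finset.card_pos.1 (huv ▸ Nat.one_pos)
      obtain ⟨hP, he⟩ := Finset.mem_filter.1 hpq
      refine Finset.mem_image.2 ⟨(p, q), Finset.mem_filter.2 ⟨hP, ?_⟩, he⟩
      rcases Sym2.eq_iff.1 he with ⟨rfl, rfl⟩ | ⟨rfl, rfl⟩
      exacts [⟨hu, hv⟩, ⟨hv, hu⟩]
    intro e he
    simp only [Finset.mem_insert, Finset.mem_singleton] at he
    rcases he with rfl | rfl | rfl
    · exact key a b h1 (by simp) (by simp)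
    · exact key b c h2 (by simp) (by simp)
    · exact key a c h3 (by simp) (by simp)
  have hthree : ({s(a, b), s(b, c), s(a, c)} : Finset (Sym2 V)).card = 3 := by
    refine Finset.card_eq_three.2 ⟨_, _, _, ?_, ?_, ?_, rfl⟩ <;>
      simp [hab.ne, hbc.ne, hac.ne, hab.ne', hac.ne']
  have := (Finset.card_le_card hsub).trans Finset.card_image_le
  omega

theorem IsTwoMatchingVec.add_le_two {G : SimpleGraph V} {x : Sym2 V → ℕ}
    (hx : IsTwoMatchingVec G x) {e f : Sym2 V} (hef : e ≠ f) {v : V} (he : v ∈ e) (hf : v ∈ f)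
    (hxe : x e ≠ 0) (hxf : x f ≠ 0) : x e + x f ≤ 2 := by
  rw [← Finset.sum_pair hef]
  refine (Finset.sum_le_sum_of_subset fun d hd => ?_).trans (hx.2 v)
  rcases Finset.mem_insert.1 hd with rfl | hd
  · exact Finset.mem_filter.2 ⟨hx.1 _ hxe, he⟩
  · rw [Finset.mem_singleton.1 hd]
    exact Finset.mem_filter.2 ⟨hx.1 _ hxf, hf⟩

theorem IsTwoMatchingVec.le_two {G : SimpleGraph V} {x : Sym2 V → ℕ}
    (hx : IsTwoMatchingVec G x) (e : Sym2 V) : x e ≤ 2 := by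
  by_cases he : x e = 0
  · omega
  · induction e using Sym2.ind with
    | _ a b =>
    exact (Finset.single_le_sum (f := x) (fun _ _ => Nat.zero_le _)
      (Finset.mem_filter.2 ⟨hx.1 _ he, Sym2.mem_mk_left a b⟩)).trans (hx.2 a)

/-- Every `2`-matching is the sum of the underlying edges of a set of arcs with all in- and
outdegrees at most one. -/
theorem IsTwoMatchingVec.exists_arcs {G : SimpleGraph V} {x : Sym2 V → ℕ}
    (hx : IsTwoMatchingVec G x) :
    ∃ P : Finset (V × V), (∀ e, (arcsOver P e).card = x e) ∧
      (∀ u v v', (u, v) ∈ P → (u, v') ∈ P → v = v') ∧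
      ∀ u u' v, (u, v) ∈ P → (u', v) ∈ P → u = u' := by
  obtain ⟨R, hR⟩ := exists_isPathOrientation (G.edgeFinset.filter (fun e => x e = 1))
    (fun e he => G.not_isDiag_of_mem_edgeFinset (Finset.mem_filter.1 he).1) (fun v => by
      rw [degF, Finset.card_eq_sum_ones, Finset.filter_comm]
      refine le_trans ?_ (hx.2 v)
      rw [Finset.sum_filter]
      refine Finset.sum_le_sum fun e _ => ?_
      split_ifs with h <;> omega)
  have hR1 : ∀ {u v}, R u v → x s(u, v) = 1 := fun h => (Finset.mem_filter.1 (hR.mem_of_rel h)).2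
  have hR1' : ∀ {u v}, x s(u, v) = 1 → R u v ∨ R v u := fun h =>
    hR.rel_of_mem (Finset.mem_filter.2 ⟨hx.1 _ (by omega), h⟩)
  refine ⟨Finset.univ.filter (fun p => R p.1 p.2 ∨ x s(p.1, p.2) = 2), ?_, ?_, ?_⟩
  · intro e
    induction e using Sym2.ind with
    | _ a b =>
    have hmem : ∀ p : V × V, p ∈ arcsOver (Finset.univ.filter
        (fun p => R p.1 p.2 ∨ x s(p.1, p.2) = 2)) s(a, b) ↔
        (p = (a, b) ∧ (R a b ∨ x s(a, b) = 2)) ∨ (p = (b, a) ∧ (R b a ∨ x s(a, b) = 2)) := by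
      rintro ⟨u, v⟩
      simp only [arcsOver, Finset.mem_filter, Finset.mem_univ, true_and, Sym2.eq_iff,
        Prod.mk.injEq]
      constructor
      · rintro ⟨h, ⟨rfl, rfl⟩ | ⟨rfl, rfl⟩⟩
        · exact Or.inl ⟨⟨rfl, rfl⟩, h⟩
        · exact Or.inr ⟨⟨rfl, rfl⟩, Sym2.eq_swap (a := u) (b := v) ▸ h⟩
      · rintro (⟨⟨rfl, rfl⟩, h⟩ | ⟨⟨rfl, rfl⟩, h⟩)
        · exact ⟨h, Or.inl ⟨rfl, rfl⟩⟩
        · exact ⟨Sym2.eq_swap (a := u) (b := v) ▸ h, Or.inr ⟨rfl, rfl⟩⟩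
    have hswap : x s(b, a) = x s(a, b) := by rw [Sym2.eq_swap]
    have hle := hx.le_two s(a, b)
    rcases (by omega : x s(a, b) = 0 ∨ x s(a, b) = 1 ∨ x s(a, b) = 2) with h | h | h
    · rw [h, Finset.card_eq_zero, Finset.eq_empty_iff_forall_notMem]
      intro p hp
      rcases (hmem p).1 hp with ⟨_, h' | h'⟩ | ⟨_, h' | h'⟩
      · have := hR1 h'; omega
      · omega
      · have := hR1 h'; omega
      · omega
    · rw [h, Finset.card_eq_one]
      rcases hR1' h with h' | h'
      · refine ⟨(a, b), Finset.ext fun p => ?_⟩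
        simp [hmem, h, h', hR.asymm h']
      · refine ⟨(b, a), Finset.ext fun p => ?_⟩
        simp [hmem, h, h', hR.asymm h']
    · rw [h, Finset.card_eq_two]
      have hab : a ≠ b := by
        simpa using G.not_isDiag_of_mem_edgeFinset (hx.1 s(a, b) (by omega))
      refine ⟨(a, b), (b, a), by simp [hab], Finset.ext fun p => ?_⟩
      simp [hmem, h]
  · intro u v v' h h'
    simp only [Finset.mem_filter, Finset.mem_univ, true_and] at h h'
    by_contra hne
    have hadd := hx.add_le_two (e := s(u, v)) (f := s(u, v')) (v := u)
      (fun h => hne (Sym2.congr_right.1 h)) (by simp) (by simp)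
    rcases h with h | h <;> rcases h' with h' | h'
    · exact hne (hR.out_unique h h')
    · have := hR1 h; omega
    · have := hR1 h'; omega
    · omega
  · intro u u' v h h'
    simp only [Finset.mem_filter, Finset.mem_univ, true_and] at h h'
    by_contra hne
    have hadd := hx.add_le_two (e := s(u, v)) (f := s(u', v)) (v := v)
      (fun h => hne (Sym2.congr_left.1 h)) (by simp) (by simp)
    rcases h with h | h <;> rcases h' with h' | h'
    · exact hne (hR.in_unique h h')
    · have := hR1 h; omega
    · have := hR1 h'; omega
    · omega

theorem isUFeasible_of_isTriangleFree {G : SimpleGraph V} {x : Sym2 V → ℕ}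
    (hx : IsTwoMatchingVec G x) (hT : IsTriangleFree G x) {P : Finset (V × V)}
    (hcard : ∀ e, (arcsOver P e).card = x e)
    (hout : ∀ u v v', (u, v) ∈ P → (u, v') ∈ P → v = v')
    (hin : ∀ u u' v, (u, v) ∈ P → (u', v) ∈ P → u = u') :
    IsUFeasible (P.map hatArc) (tripleFamily V) 1 := by
  rw [isUFeasible_map_hatArc_iff]
  intro U hU
  by_contra! hlt
  have hpos : ∀ {u v}, (u, v) ∈ P → x s(u, v) ≠ 0 := by
    intro u v h
    rw [← hcard]
    exact Finset.card_ne_zero_of_mem (Finset.mem_filter.2 ⟨h, rfl⟩)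
  have hadj : ∀ {u v}, (u, v) ∈ P → G.Adj u v := fun h => by simpa using hx.1 _ (hpos h)
  have hsucc : ∀ u ∈ U, ∃ v ∈ U, (u, v) ∈ P := by
    have himg : (P.filter (fun p => p.1 ∈ U ∧ p.2 ∈ U)).image Prod.fst = U := by
      refine Finset.eq_of_subset_of_card_le ?_ ?_
      · intro u hu
        obtain ⟨p, hp, rfl⟩ := Finset.mem_image.1 hu
        exact (Finset.mem_filter.1 hp).2.1
      · rw [Finset.card_image_of_injOn]
        · omega
        · rintro ⟨u, v⟩ hp ⟨u', v'⟩ hq (rfl : u = u')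
          rw [hout u v v' (Finset.mem_filter.1 hp).1 (Finset.mem_filter.1 hq).1]
    intro u hu
    rw [← himg] at hu
    obtain ⟨⟨_, v⟩, hp, rfl⟩ := Finset.mem_image.1 hu
    exact ⟨v, (Finset.mem_filter.1 hp).2.2, (Finset.mem_filter.1 hp).1⟩
  have hcycle : ∀ a b c : V, (a, b) ∈ P → (b, c) ∈ P → (c, a) ∈ P → False := by
    intro a b c hab hbc hca
    have h1 := hpos hab
    have h2 := hpos hbc
    have h3 := hpos hca
    have n1 := (hadj hab).ne
    have n2 := (hadj hbc).ne
    have n3 := (hadj hca).ne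
    have s1 := hx.add_le_two (e := s(a, b)) (f := s(b, c)) (v := b)
      (by simp [n1, n3.symm]) (by simp) (by simp) h1 h2
    have s2 := hx.add_le_two (e := s(b, c)) (f := s(c, a)) (v := c)
      (by simp [n1.symm, n2]) (by simp) (by simp) h2 h3
    refine hT ⟨a, b, c, hadj hab, hadj hbc, (hadj hca).symm, by omega, by omega, ?_⟩
    rw [Sym2.eq_swap]
    omega
  obtain ⟨a, b, c, hab, hac, hbc, rfl⟩ := Finset.card_eq_three.1 hU
  have hnoloop : ∀ u, (u, u) ∉ P := fun u h => (hadj h).ne rfl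
  obtain ⟨a', ha', hPa⟩ := hsucc a (by simp)
  obtain ⟨b', hb', hPb⟩ := hsucc b (by simp)
  obtain ⟨c', hc', hPc⟩ := hsucc c (by simp)
  simp only [Finset.mem_insert, Finset.mem_singleton] at ha' hb' hc'
  grind

/-- The reduction of triangle-free `2`-matchings in `G` to `Û`-feasible `1`-matchings
in the bipartite graph `Ĝ`, with `Û = { Û : U ⊆ V, |U| = 3 }`:
(i) every triangle-free `2`-matching `x` of `G` yields a `Û`-feasible `1`-matching `F̂`
of `Ĝ` with `ŵ(F̂) = Σ_e w(e)·x(e)`, and (ii) conversely. -/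
theorem triangle_free_two_matching_reduction (G : SimpleGraph V)
    (w : Sym2 V → ℝ) (hw : ∀ e ∈ G.edgeFinset, 0 ≤ w e) :
    (∀ x : Sym2 V → ℕ, IsTwoMatchingVec G x → IsTriangleFree G x →
      ∃ Fhat : Finset (Sym2 (V ⊕ V)), Fhat ⊆ hatEdges G ∧
        IsTMatching Fhat 1 ∧ IsUFeasible Fhat (tripleFamily V) 1 ∧
        (∑ e ∈ Fhat, hatw w e) = ∑ e ∈ G.edgeFinset, w e * x e) ∧
    (∀ Fhat : Finset (Sym2 (V ⊕ V)), Fhat ⊆ hatEdges G →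
      IsTMatching Fhat 1 → IsUFeasible Fhat (tripleFamily V) 1 →
      ∃ x : Sym2 V → ℕ, IsTwoMatchingVec G x ∧ IsTriangleFree G x ∧
        (∑ e ∈ G.edgeFinset, w e * x e) = ∑ e ∈ Fhat, hatw w e) := by
  refine ⟨fun x hx hT => ?_, fun F hF hM hU => ?_⟩
  · obtain ⟨P, hcard, hout, hin⟩ := hx.exists_arcs
    have hadj : ∀ p ∈ P, G.Adj p.1 p.2 := by
      intro p hp
      have h : x s(p.1, p.2) ≠ 0 := by
        rw [← hcard]
        exact Finset.card_ne_zero_of_mem (Finset.mem_filter.2 ⟨hp, rfl⟩)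
      simpa using hx.1 _ h
    refine ⟨P.map hatArc, ?_, ?_, isUFeasible_of_isTriangleFree hx hT hcard hout hin, ?_⟩
    · intro e he
      obtain ⟨p, hp, rfl⟩ := Finset.mem_map.1 he
      exact Finset.mem_filter.2 ⟨Finset.mem_univ _, p.1, p.2, hadj p hp, rfl⟩
    · rintro (v | v)
      · rw [degF_map_hatArc_inl, Finset.card_le_one]
        rintro ⟨u, a⟩ ha ⟨u', b⟩ hb
        simp only [Finset.mem_filter] at ha hb
        obtain ⟨ha, rfl⟩ := ha
        obtain ⟨hb, rfl⟩ := hb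
        rw [hout _ _ _ ha hb]
      · rw [degF_map_hatArc_inr, Finset.card_le_one]
        rintro ⟨a, u⟩ ha ⟨b, u'⟩ hb
        simp only [Finset.mem_filter] at ha hb
        obtain ⟨ha, rfl⟩ := ha
        obtain ⟨hb, rfl⟩ := hb
        rw [hin _ _ _ ha hb]
    · rw [sum_hatw_map_hatArc G w P hadj]
      simp only [hcard]
  · obtain ⟨P, hadj, rfl⟩ := exists_map_hatArc_eq hF
    exact ⟨fun e => (arcsOver P e).card, isTwoMatchingVec_card_arcsOver hadj hM,
      isTriangleFree_card_arcsOver hU, (sum_hatw_map_hatArc G w P hadj).symm⟩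
end
end

section
/- Let M be a matroid on a finite ground set V with circuit family C ⊆ 2^V. Define the bipartite graph Ĝ=(V̂,Ê) with V̂⁺ = {v⁺ : v ∈ V}, V̂⁻ = {v⁻ : v ∈ V}, Ê = { {v⁺,v⁻} : v ∈ V }, and Û = { ∪_{v∈C} {v⁺,v⁻} : C ∈ C }. Then a set I ⊆ V is independent in M if and only if the edge set { {v⁺,v⁻} : v ∈ I } is a Û-feasible 1-matching of Ĝ. -/
open scoped Classical

noncomputable section

variable {V : Type*} [Fintype V] [DecidableEq V]

/-- The circuits of the matroid `M`: the minimal dependent sets. -/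
def matroidCircuits (M : Matroid V) : Finset (Finset V) :=
  Finset.univ.filter (fun C => Minimal (fun S : Finset V => M.Dep (↑S : Set V)) C)

/-- The edge set `Ê = { {v⁺, v⁻} : v ∈ V }` of the bipartite graph `Ĝ`. -/
def diagEdges (V : Type*) [Fintype V] [DecidableEq V] : Finset (Sym2 (V ⊕ V)) :=
  Finset.univ.image (fun v : V => s(Sum.inl v, Sum.inr v))

omit [Fintype V] [DecidableEq V] in
theorem injective_diagEdge :
    Function.Injective (fun v : V => (s(Sum.inl v, Sum.inr v) : Sym2 (V ⊕ V))) := by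
  intro a b h
  simpa using h

omit [Fintype V] in
theorem isTMatching_image_diagEdge (I : Finset V) :
    IsTMatching (I.image (fun v => (s(Sum.inl v, Sum.inr v) : Sym2 (V ⊕ V)))) 1 := by
  intro w
  rw [degF, Finset.card_le_one]
  intro e he f hf
  simp only [Finset.mem_filter, Finset.mem_image] at he hf
  obtain ⟨⟨a, -, rfl⟩, ha⟩ := he
  obtain ⟨⟨b, -, rfl⟩, hb⟩ := hf
  cases w <;> simp_all

theorem card_inducedEdges_image_diagEdge (I C : Finset V) :
    (inducedEdges (I.image (fun v => (s(Sum.inl v, Sum.inr v) : Sym2 (V ⊕ V))))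
      (hatVertexSet C)).card = (I ∩ C).card := by
  rw [← Finset.card_image_of_injective (I ∩ C) injective_diagEdge]
  congr 1
  ext e
  rw [inducedEdges, Finset.mem_filter]
  simp only [hatVertexSet, Finset.mem_image, Finset.mem_inter]
  constructor
  · rintro ⟨⟨a, ha, rfl⟩, h⟩
    exact ⟨a, ⟨ha, by simpa using h (Sum.inl a) (by simp)⟩, rfl⟩
  · rintro ⟨a, ⟨ha, hC⟩, rfl⟩
    exact ⟨⟨a, ha, rfl⟩, by simp [hC]⟩

omit [Fintype V] in
theorem card_hatVertexSet (C : Finset V) : (hatVertexSet C).card = 2 * C.card := by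
  rw [hatVertexSet, Finset.card_union_of_disjoint,
    Finset.card_image_of_injective _ Sum.inl_injective,
    Finset.card_image_of_injective _ Sum.inr_injective, two_mul]
  simp [Finset.disjoint_left]

omit [Fintype V] in
theorem ufBound_one_hatVertexSet (C : Finset V) :
    ufBound 1 (hatVertexSet C) = (C.card : ℤ) - 1 := by
  rw [ufBound, card_hatVertexSet, Int.floor_eq_iff]
  push_cast
  constructor <;> linarith

theorem isUFeasible_image_diagEdge_iff (I : Finset V) (𝒞 : Finset (Finset V)) :
    IsUFeasible (I.image (fun v => (s(Sum.inl v, Sum.inr v) : Sym2 (V ⊕ V))))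
      (𝒞.image hatVertexSet) 1 ↔ ∀ C ∈ 𝒞, ¬ C ⊆ I := by
  rw [IsUFeasible, Finset.forall_mem_image]
  refine forall₂_congr fun C _ => ?_
  rw [card_inducedEdges_image_diagEdge, ufBound_one_hatVertexSet, Int.le_sub_one_iff,
    Nat.cast_lt, ← Finset.inter_eq_right, ← not_le]
  exact not_congr ⟨Finset.eq_of_subset_of_card_le Finset.inter_subset_right, fun h => by rw [h]⟩

omit [DecidableEq V] in
theorem indep_iff_forall_matroidCircuits (M : Matroid V) (hE : M.E = Set.univ) (I : Finset V) :
    M.Indep (↑I : Set V) ↔ ∀ C ∈ matroidCircuits M, ¬ C ⊆ I := by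
  simp only [matroidCircuits, Finset.mem_filter, Finset.mem_univ, true_and]
  constructor
  · intro hI C hC hCI
    exact hC.prop.not_indep (hI.subset (Finset.coe_subset.2 hCI))
  · intro h
    by_contra hI
    have hdep : M.Dep (↑I : Set V) := ⟨hI, by simp [hE]⟩
    obtain ⟨C, hCI, hC⟩ :=
      exists_minimal_le_of_wellFoundedLT (fun S : Finset V => M.Dep (↑S : Set V)) I hdep
    exact h C hC hCI

/-- A set `I ⊆ V` is independent in the matroid `M` (with ground set `V` and circuit
family `𝒞`) if and only if `{ {v⁺, v⁻} : v ∈ I }` is a `Û`-feasible `1`-matching of the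
bipartite graph `Ĝ = (V̂, Ê)`, where `Ê = { {v⁺,v⁻} : v ∈ V }` and
`Û = { ∪_{v ∈ C} {v⁺, v⁻} : C ∈ 𝒞 }`. -/
theorem matroid_independent_iff_hat_feasible (M : Matroid V) (hE : M.E = Set.univ)
    (I : Finset V) :
    M.Indep (↑I : Set V) ↔
      ((I.image (fun v => s(Sum.inl v, Sum.inr v)) : Finset (Sym2 (V ⊕ V)))
          ⊆ diagEdges V ∧
        IsTMatching (I.image (fun v => s(Sum.inl v, Sum.inr v))) 1 ∧
        IsUFeasible (I.image (fun v => s(Sum.inl v, Sum.inr v)))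
          ((matroidCircuits M).image hatVertexSet) 1) := by
  rw [isUFeasible_image_diagEdge_iff, ← indep_iff_forall_matroidCircuits M hE]
  exact ⟨fun h => ⟨Finset.image_subset_image (Finset.subset_univ I),
    isTMatching_image_diagEdge I, h⟩, fun h => h.2.2⟩
end
end
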